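/- If two symmetric positive definite 2×2 real matrices A and B with det(A)=det(B)=1 are distinct, then det(A−B) < 0. -/

import Mathlib

open Matrix

theorem det_sub_neg_of_posdef_det_one
    (A B : Matrix (Fin 2) (Fin 2) ℝ)
    (hA : A.PosDef) (hB : B.PosDef)
    (hdA : A.det = 1) (hdB : B.det = 1)
    (hne : A ≠ B) :
    (A - B).det < 0 := by
  have ha : 0 < A 0 0 := hA.diag_pos
  have hp : 0 < B 0 0 := hB.diag_pos
  have hsA : A 1 0 = A 0 1 := by simpa using hA.isHermitian.apply 0 1
  have hsB : B 1 0 = B 0 1 := by simpa using hB.isHermitian.apply 0 1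
  rw [Matrix.det_fin_two] at hdA hdB ⊢
  simp only [Matrix.sub_apply]
  rw [hsA] at hdA
  rw [hsB] at hdB
  rw [hsA, hsB]
  have hap := mul_pos ha hp
  by_contra hcon
  push Not at hcon
  have key : A 0 0 * B 0 0 * ((A 0 0 - B 0 0) * (A 1 1 - B 1 1)
      - (A 0 1 - B 0 1) * (A 0 1 - B 0 1))
      = -((A 0 0 - B 0 0) ^ 2 + (A 0 0 * B 0 1 - B 0 0 * A 0 1) ^ 2) := by
    linear_combination (A 0 0 * B 0 0 - B 0 0 ^ 2) * hdA + (A 0 0 * B 0 0 - A 0 0 ^ 2) * hdB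
  have h0 := mul_nonneg hap.le hcon
  rw [key] at h0
  have h1 : A 0 0 - B 0 0 = 0 := by
    apply pow_eq_zero_iff (two_ne_zero) |>.mp
    nlinarith [sq_nonneg (A 0 0 - B 0 0), sq_nonneg (A 0 0 * B 0 1 - B 0 0 * A 0 1)]
  have h2 : A 0 0 * B 0 1 - B 0 0 * A 0 1 = 0 := by
    apply pow_eq_zero_iff (two_ne_zero) |>.mp
    nlinarith [sq_nonneg (A 0 0 - B 0 0), sq_nonneg (A 0 0 * B 0 1 - B 0 0 * A 0 1)]
  have e1 : A 0 0 = B 0 0 := by linarith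
  have e2 : A 0 1 = B 0 1 := by
    apply mul_left_cancel₀ hp.ne'
    rw [e1] at h2
    linarith
  have e3 : A 1 1 = B 1 1 := by
    apply mul_left_cancel₀ hp.ne'
    rw [e1, e2] at hdA
    linarith
  apply hne
  ext i j
  fin_cases i <;> fin_cases j
  · exact e1
  · exact e2
  · exact hsA.trans (e2.trans hsB.symm)
  · exact e3
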